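/- arXiv:1602.02020 — 3 statements merged into one kernel-verified Lean document; each statement's English description precedes it below -/
import Mathlib

section
/- Algebraic decay of the cross Gram matrix entries: along any solution of the continuous-time EnKF flow with y = A u†, each entry of F satisfies F_{ij}(t)² ≤ ‖A r^{(i)}(t)‖_Γ² · ‖A e^{(j)}(t)‖_Γ² ≤ C · E_{jj}(t) for a constant C depending only on the initial conditions; since E_{jj}(t) = O(J/t), it follows that |F_{ij}(t)| ≤ C' t^{-1/2} as t → ∞ for some constant C' depending only on initial conditions, and in particular F is bounded uniformly in time. -/
open scoped BigOperators
open RealInnerProductSpace Matrix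

noncomputable section

/-- The Γ-weighted inner product `⟨a,b⟩_Γ = ⟨Γ⁻¹ a, b⟩` on `ℝ^K`. -/
def gInner {K : ℕ} (Γ : Matrix (Fin K) (Fin K) ℝ)
    (a b : EuclideanSpace ℝ (Fin K)) : ℝ :=
  ⟪Matrix.toEuclideanLin Γ⁻¹ a, b⟫

/-- Ensemble mean. -/
def ensMean {X : Type*} [AddCommGroup X] [Module ℝ X] {J : ℕ} (v : Fin J → X) : X :=
  (J : ℝ)⁻¹ • ∑ j, v j

/-- Right-hand side of the continuous-time EnKF flow. -/
def enkfRHS {X : Type*} [NormedAddCommGroup X] [InnerProductSpace ℝ X] {K J : ℕ}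
    (A : X →L[ℝ] EuclideanSpace ℝ (Fin K)) (Γ : Matrix (Fin K) (Fin K) ℝ)
    (y : EuclideanSpace ℝ (Fin K)) (v : Fin J → X) (j : Fin J) : X :=
  (J : ℝ)⁻¹ • ∑ k, gInner Γ (A (v k - ensMean v)) (y - A (v j)) • (v k - ensMean v)

/-- `u : ℝ → Fin J → X` solves the continuous-time EnKF flow on `[0,∞)`. -/
def IsEnKFSolution {X : Type*} [NormedAddCommGroup X] [InnerProductSpace ℝ X] {K J : ℕ}
    (A : X →L[ℝ] EuclideanSpace ℝ (Fin K)) (Γ : Matrix (Fin K) (Fin K) ℝ)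
    (y : EuclideanSpace ℝ (Fin K)) (u : ℝ → Fin J → X) : Prop :=
  ∀ j : Fin J, ∀ t ∈ Set.Ici (0 : ℝ),
    HasDerivWithinAt (fun s => u s j) (enkfRHS A Γ y (u t) j) (Set.Ici 0) t

/-- The deviation Gram matrix `E` of an ensemble. -/
def matE {X : Type*} [NormedAddCommGroup X] [InnerProductSpace ℝ X] {K J : ℕ}
    (A : X →L[ℝ] EuclideanSpace ℝ (Fin K)) (Γ : Matrix (Fin K) (Fin K) ℝ)
    (v : Fin J → X) : Matrix (Fin J) (Fin J) ℝ :=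
  Matrix.of fun l j => gInner Γ (A (v l - ensMean v)) (A (v j - ensMean v))

/-- The residual/deviation cross Gram matrix `F` of an ensemble. -/
def matF {X : Type*} [NormedAddCommGroup X] [InnerProductSpace ℝ X] {K J : ℕ}
    (A : X →L[ℝ] EuclideanSpace ℝ (Fin K)) (Γ : Matrix (Fin K) (Fin K) ℝ)
    (udag : X) (v : Fin J → X) : Matrix (Fin J) (Fin J) ℝ :=
  Matrix.of fun l j => gInner Γ (A (v l - udag)) (A (v j - ensMean v))

/-- The residual Gram matrix `R` of an ensemble. -/
def matR {X : Type*} [NormedAddCommGroup X] [InnerProductSpace ℝ X] {K J : ℕ}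
    (A : X →L[ℝ] EuclideanSpace ℝ (Fin K)) (Γ : Matrix (Fin K) (Fin K) ℝ)
    (udag : X) (v : Fin J → X) : Matrix (Fin J) (Fin J) ℝ :=
  Matrix.of fun l j => gInner Γ (A (v l - udag)) (A (v j - udag))

/-- The orthogonal complement of a subspace of `ℝ^K` w.r.t. the Γ-weighted inner product. -/
def gOrth {K : ℕ} (Γ : Matrix (Fin K) (Fin K) ℝ)
    (S : Submodule ℝ (EuclideanSpace ℝ (Fin K))) :
    Submodule ℝ (EuclideanSpace ℝ (Fin K)) where
  carrier := {w | ∀ v ∈ S, gInner Γ v w = 0}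
  add_mem' := by
    intro a b ha hb v hv
    have h1 := ha v hv
    have h2 := hb v hv
    simp only [gInner, Set.mem_setOf_eq] at *
    rw [inner_add_right, h1, h2, add_zero]
  zero_mem' := by
    intro v hv
    simp [gInner]
  smul_mem' := by
    intro c a ha v hv
    have h1 := ha v hv
    simp only [gInner, Set.mem_setOf_eq] at *
    rw [inner_smul_right, h1, mul_zero]

/-- The orthogonal complement of a subspace of `X` w.r.t. the inner product
`⟨v,w⟩_* = ⟨A v, A w⟩_Γ`. -/
def gOrthX {X : Type*} [NormedAddCommGroup X] [InnerProductSpace ℝ X] {K : ℕ}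
    (A : X →L[ℝ] EuclideanSpace ℝ (Fin K)) (Γ : Matrix (Fin K) (Fin K) ℝ)
    (S : Submodule ℝ X) : Submodule ℝ X where
  carrier := {w | ∀ v ∈ S, gInner Γ (A v) (A w) = 0}
  add_mem' := by
    intro a b ha hb v hv
    have h1 := ha v hv
    have h2 := hb v hv
    simp only [gInner, Set.mem_setOf_eq, map_add] at *
    rw [inner_add_right, h1, h2, add_zero]
  zero_mem' := by
    intro v hv
    simp [gInner]
  smul_mem' := by
    intro c a ha v hv
    have h1 := ha v hv
    simp only [gInner, Set.mem_setOf_eq, _root_.map_smul] at *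
    rw [inner_smul_right, h1, mul_zero]


theorem gI_pos {K : ℕ} {Γ : Matrix (Fin K) (Fin K) ℝ} (hΓ : Γ.PosDef) :
    (Matrix.toEuclideanLin Γ⁻¹).IsPositive :=
  Matrix.isPositive_toEuclideanLin_iff.2 hΓ.inv.posSemidef

theorem gI_comm {K : ℕ} {Γ : Matrix (Fin K) (Fin K) ℝ} (hΓ : Γ.PosDef)
    (a b : EuclideanSpace ℝ (Fin K)) : gInner Γ a b = gInner Γ b a := by
  unfold gInner
  rw [(gI_pos hΓ).isSymmetric a b, real_inner_comm]

theorem gI_nonneg {K : ℕ} {Γ : Matrix (Fin K) (Fin K) ℝ} (hΓ : Γ.PosDef)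
    (a : EuclideanSpace ℝ (Fin K)) : 0 ≤ gInner Γ a a := by
  have := (gI_pos hΓ).2 a
  simpa [gInner] using this

theorem gI_cs {K : ℕ} {Γ : Matrix (Fin K) (Fin K) ℝ} (hΓ : Γ.PosDef)
    (a b : EuclideanSpace ℝ (Fin K)) :
    (gInner Γ a b) ^ 2 ≤ gInner Γ a a * gInner Γ b b := by
  have h : ∀ x : ℝ, 0 ≤ gInner Γ a a * (x * x) + (2 * gInner Γ a b) * x + gInner Γ b b := by
    intro x
    have h1 := gI_nonneg hΓ (x • a + b)
    have h2 : gInner Γ (x • a + b) (x • a + b) =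
        gInner Γ a a * (x * x) + (gInner Γ a b + gInner Γ b a) * x + gInner Γ b b := by
      simp only [gInner, map_add, _root_.map_smul, inner_add_left, inner_add_right,
        real_inner_smul_left, real_inner_smul_right]
      ring
    rw [h2, gI_comm hΓ b a] at h1
    linarith
  have := discrim_le_zero h
  unfold discrim at this
  nlinarith

theorem gI_deriv {K J : ℕ} {Γ : Matrix (Fin K) (Fin K) ℝ} (hΓ : Γ.PosDef)
    (p : ℝ → EuclideanSpace ℝ (Fin K)) (w : Fin J → EuclideanSpace ℝ (Fin K)) (t : ℝ)
    (hp : HasDerivWithinAt p (-((J : ℝ)⁻¹ • ∑ k, gInner Γ (w k) (p t) • w k)) (Set.Ici 0) t) :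
    HasDerivWithinAt (fun s => gInner Γ (p s) (p s))
      (-(2 * (J : ℝ)⁻¹) * ∑ k, (gInner Γ (w k) (p t)) ^ 2) (Set.Ici 0) t := by
  have hL := (LinearMap.toContinuousLinearMap
    (Matrix.toEuclideanLin Γ⁻¹)).hasFDerivAt.comp_hasDerivWithinAt t hp
  have h := HasDerivWithinAt.inner ℝ hL hp
  refine h.congr_deriv ?_
  have e : ∀ d, ⟪Matrix.toEuclideanLin Γ⁻¹ d, p t⟫ = ⟪Matrix.toEuclideanLin Γ⁻¹ (p t), d⟫ :=
    fun d => gI_comm hΓ d (p t)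
  have e2 : ⟪Matrix.toEuclideanLin Γ⁻¹ (p t), -((J : ℝ)⁻¹ • ∑ k, gInner Γ (w k) (p t) • w k)⟫
      = -((J : ℝ)⁻¹ * ∑ k, (gInner Γ (w k) (p t)) ^ 2) := by
    rw [inner_neg_right, real_inner_smul_right, inner_sum]
    congr 2
    refine Finset.sum_congr rfl fun k _ => ?_
    rw [real_inner_smul_right, ← e, sq]
    rfl
  change ⟪Matrix.toEuclideanLin Γ⁻¹ (p t), _⟫ + ⟪Matrix.toEuclideanLin Γ⁻¹ _, p t⟫ = _
  rw [e, e2]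
  ring

theorem anti_of_deriv {f f' : ℝ → ℝ}
    (hf : ∀ t ∈ Set.Ici (0 : ℝ), HasDerivWithinAt f (f' t) (Set.Ici 0) t)
    (hf' : ∀ t ∈ Set.Ici (0 : ℝ), f' t ≤ 0) : AntitoneOn f (Set.Ici 0) := by
  refine antitoneOn_of_hasDerivWithinAt_nonpos (convex_Ici 0)
    (fun t ht => (hf t ht).continuousWithinAt)
    (fun t ht => (hf t (interior_subset ht)).mono interior_subset)
    (fun t ht => hf' t (interior_subset ht))

theorem riccati_bound {f f' : ℝ → ℝ} {c : ℝ} (hc : 0 < c)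
    (hf : ∀ t ∈ Set.Ici (0 : ℝ), HasDerivWithinAt f (f' t) (Set.Ici 0) t)
    (hf' : ∀ t ∈ Set.Ici (0 : ℝ), f' t ≤ -c * (f t) ^ 2)
    (t : ℝ) (ht : 0 < t) : f t ≤ 1 / (c * t) := by
  have hanti := anti_of_deriv hf (fun t ht => (hf' t ht).trans (by nlinarith [sq_nonneg (f t)]))
  rcases le_or_gt (f t) 0 with h0 | h0
  · exact h0.trans (by positivity)
  have hpos : ∀ s ∈ Set.Icc 0 t, 0 < f s := fun s hs =>
    h0.trans_le (hanti hs.1 ht.le hs.2)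
  have hsub : Set.Icc 0 t ⊆ Set.Ici (0 : ℝ) := fun s hs => hs.1
  have hd : ∀ s ∈ Set.Icc 0 t, HasDerivWithinAt (fun s => (f s)⁻¹ - c * s)
      (-f' s / (f s) ^ 2 - c * 1) (Set.Icc 0 t) s := fun s hs =>
    (((hf s hs.1).mono hsub).fun_inv (hpos s hs).ne').sub
      ((hasDerivWithinAt_id s _).const_mul c)
  have hm : MonotoneOn (fun s => (f s)⁻¹ - c * s) (Set.Icc 0 t) := by
    refine monotoneOn_of_hasDerivWithinAt_nonneg (convex_Icc 0 t)
      (fun t ht => (hd t ht).continuousWithinAt)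
      (fun t ht => (hd t (interior_subset ht)).mono interior_subset) ?_
    intro s hs
    have hs := interior_subset hs
    have := hpos s hs
    have h2 := hf' s hs.1
    rw [sub_nonneg, le_div_iff₀ (by positivity)]
    linarith
  have h1 := hm ⟨le_rfl, ht.le⟩ ⟨ht.le, le_rfl⟩ ht.le
  simp only [mul_zero, sub_zero] at h1
  have h3 : 0 < (f 0)⁻¹ := inv_pos.2 (hpos 0 ⟨le_rfl, ht.le⟩)
  have h4 : c * t ≤ (f t)⁻¹ := by linarith
  rw [one_div]
  exact (le_inv_comm₀ (by positivity) h0).1 h4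

theorem deriv_r {X : Type*} [NormedAddCommGroup X] [InnerProductSpace ℝ X]
    {K J : ℕ} (A : X →L[ℝ] EuclideanSpace ℝ (Fin K))
    (Γ : Matrix (Fin K) (Fin K) ℝ)
    (udag : X) (u : ℝ → Fin J → X)
    (hu : IsEnKFSolution A Γ (A udag) u) (t : ℝ) (ht : t ∈ Set.Ici (0 : ℝ)) (i : Fin J) :
    HasDerivWithinAt (fun s => A (u s i - udag))
      (-((J : ℝ)⁻¹ • ∑ k, gInner Γ (A (u t k - ensMean (u t))) (A (u t i - udag)) •
        A (u t k - ensMean (u t)))) (Set.Ici 0) t := by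
  have h := A.hasFDerivAt.comp_hasDerivWithinAt t ((hu i t ht).sub_const udag)
  refine h.congr_deriv ?_
  rw [enkfRHS, _root_.map_smul, map_sum, ← smul_neg, ← Finset.sum_neg_distrib]
  congr 1
  refine Finset.sum_congr rfl fun k _ => ?_
  rw [_root_.map_smul, ← neg_smul]
  congr 1
  rw [gInner, gInner, ← inner_neg_right, map_sub A (u t i), neg_sub]

theorem deriv_e {X : Type*} [NormedAddCommGroup X] [InnerProductSpace ℝ X]
    {K J : ℕ} (hJ : 0 < J) (A : X →L[ℝ] EuclideanSpace ℝ (Fin K))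
    (Γ : Matrix (Fin K) (Fin K) ℝ)
    (udag : X) (u : ℝ → Fin J → X)
    (hu : IsEnKFSolution A Γ (A udag) u) (t : ℝ) (ht : t ∈ Set.Ici (0 : ℝ)) (i : Fin J) :
    HasDerivWithinAt (fun s => A (u s i - ensMean (u s)))
      (-((J : ℝ)⁻¹ • ∑ k, gInner Γ (A (u t k - ensMean (u t))) (A (u t i - ensMean (u t))) •
        A (u t k - ensMean (u t)))) (Set.Ici 0) t := by
  have hJ' : (J : ℝ) ≠ 0 := by positivity
  have hr := deriv_r A Γ udag u hu t ht
  have hm := (HasDerivWithinAt.fun_sum (u := Finset.univ) (fun j _ => hr j)).const_smul ((J : ℝ)⁻¹)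
  have hmean : ∀ s, A (ensMean (u s) - udag) = (J : ℝ)⁻¹ • ∑ j, A (u s j - udag) := by
    intro s
    rw [← map_sum, ← _root_.map_smul, Finset.sum_sub_distrib, smul_sub]
    simp [ensMean, ← Nat.cast_smul_eq_nsmul ℝ, smul_smul, hJ']
  have h := (hr i).sub hm
  have hfun : (fun s => A (u s i - ensMean (u s))) =
      (fun s => A (u s i - udag)) - (fun s => (J : ℝ)⁻¹ • ∑ j, A (u s j - udag)) := by
    funext s
    rw [Pi.sub_apply, ← hmean, ← map_sub]
    congr 1
    abel
  rw [hfun]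
  refine h.congr_deriv ?_
  rw [Finset.sum_neg_distrib, ← Finset.smul_sum, smul_neg, ← neg_sub', ← smul_sub]
  congr 2
  rw [Finset.sum_comm, Finset.smul_sum, ← Finset.sum_sub_distrib]
  refine Finset.sum_congr rfl fun k _ => ?_
  rw [← Finset.sum_smul, smul_smul, ← sub_smul]
  congr 1
  have : A (u t i - ensMean (u t)) = A (u t i - udag) - A (ensMean (u t) - udag) := by
    rw [← map_sub]; congr 1; abel
  rw [this, hmean]
  simp only [gInner]
  rw [inner_sub_right, real_inner_smul_right, inner_sum]

theorem enkf_cross_gram_decay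
    {X : Type*} [NormedAddCommGroup X] [InnerProductSpace ℝ X]
    {K J : ℕ} (hJ : 0 < J)
    (A : X →L[ℝ] EuclideanSpace ℝ (Fin K))
    (Γ : Matrix (Fin K) (Fin K) ℝ) (hΓ : Γ.PosDef)
    (udag : X) (u : ℝ → Fin J → X)
    (hu : IsEnKFSolution A Γ (A udag) u) :
    (∃ C : ℝ, 0 ≤ C ∧ ∀ t ∈ Set.Ici (0 : ℝ), ∀ i j : Fin J,
      (matF A Γ udag (u t) i j) ^ 2 ≤
        gInner Γ (A (u t i - udag)) (A (u t i - udag)) * matE A Γ (u t) j j ∧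
      gInner Γ (A (u t i - udag)) (A (u t i - udag)) * matE A Γ (u t) j j ≤
        C * matE A Γ (u t) j j) ∧
    (∃ C' : ℝ, ∀ t > (0 : ℝ), ∀ i j : Fin J,
      |matF A Γ udag (u t) i j| ≤ C' * t ^ (-(1 / 2) : ℝ)) ∧
    ∃ M : ℝ, ∀ t ∈ Set.Ici (0 : ℝ), ∀ i j : Fin J,
      |matF A Γ udag (u t) i j| ≤ M := by
  have hJ' : (0 : ℝ) < J := by exact_mod_cast hJ
  have hdr : ∀ i, ∀ t ∈ Set.Ici (0 : ℝ), _ := fun i t ht =>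
    gI_deriv hΓ (fun s => A (u s i - udag)) (fun k => A (u t k - ensMean (u t))) t
      (deriv_r A Γ udag u hu t ht i)
  have hde : ∀ i, ∀ t ∈ Set.Ici (0 : ℝ), _ := fun i t ht =>
    gI_deriv hΓ (fun s => A (u s i - ensMean (u s))) (fun k => A (u t k - ensMean (u t))) t
      (deriv_e hJ A Γ udag u hu t ht i)
  have hneg : ∀ g : Fin J → ℝ, -(2 * (J : ℝ)⁻¹) * ∑ k, g k ^ 2 ≤ 0 := by
    intro g
    have h1 : 0 ≤ ∑ k, g k ^ 2 := Finset.sum_nonneg fun k _ => sq_nonneg _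
    have h2 : 0 ≤ 2 * (J : ℝ)⁻¹ := by positivity
    nlinarith [mul_nonneg h2 h1]
  have har := fun i => anti_of_deriv (hdr i) (fun t _ => hneg _)
  have hae := fun i => anti_of_deriv (hde i) (fun t _ => hneg _)
  have hEb : ∀ j, ∀ t > (0 : ℝ), matE A Γ (u t) j j ≤ 1 / (2 * (J : ℝ)⁻¹ * t) := by
    intro j t ht
    refine riccati_bound (by positivity) (hde j) ?_ t ht
    intro s _
    have h1 := Finset.single_le_sum (f := fun k =>
      gInner Γ (A (u s k - ensMean (u s))) (A (u s j - ensMean (u s))) ^ 2)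
      (fun k _ => sq_nonneg _) (Finset.mem_univ j)
    have h2 : 0 ≤ 2 * (J : ℝ)⁻¹ := by positivity
    have h3 := mul_le_mul_of_nonneg_left h1 h2
    linarith
  have hE0 : ∀ t j, 0 ≤ matE A Γ (u t) j j := fun t j => gI_nonneg hΓ _
  set C : ℝ := ∑ i, gInner Γ (A (u 0 i - udag)) (A (u 0 i - udag)) with hC
  have hC0 : 0 ≤ C := Finset.sum_nonneg fun i _ => gI_nonneg hΓ _
  have hR : ∀ t ∈ Set.Ici (0 : ℝ), ∀ i,
      gInner Γ (A (u t i - udag)) (A (u t i - udag)) ≤ C := by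
    intro t ht i
    refine (har i (Set.mem_Ici.2 le_rfl) ht ht).trans ?_
    exact Finset.single_le_sum (f := fun i => gInner Γ (A (u 0 i - udag)) (A (u 0 i - udag)))
      (fun k _ => gI_nonneg hΓ _) (Finset.mem_univ i)
  have hF1 : ∀ t i j, (matF A Γ udag (u t) i j) ^ 2 ≤
      gInner Γ (A (u t i - udag)) (A (u t i - udag)) * matE A Γ (u t) j j :=
    fun t i j => gI_cs hΓ _ _
  have hF2 : ∀ t ∈ Set.Ici (0 : ℝ), ∀ i j,
      gInner Γ (A (u t i - udag)) (A (u t i - udag)) * matE A Γ (u t) j j ≤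
        C * matE A Γ (u t) j j :=
    fun t ht i j => mul_le_mul_of_nonneg_right (hR t ht i) (hE0 t j)
  refine ⟨⟨C, hC0, fun t ht i j => ⟨hF1 t i j, hF2 t ht i j⟩⟩, ⟨√(C * (J / 2)), ?_⟩,
    ⟨√(C * ∑ j, matE A Γ (u 0) j j), ?_⟩⟩
  · intro t ht i j
    have h := ((hF1 t i j).trans (hF2 t ht.le i j)).trans
      (mul_le_mul_of_nonneg_left (hEb j t ht) hC0)
    have e : C * (1 / (2 * (J : ℝ)⁻¹ * t)) = (C * (J / 2)) * t⁻¹ := by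
      field_simp
    rw [e] at h
    have h5 := Real.abs_le_sqrt h
    rw [Real.sqrt_mul (by positivity), Real.sqrt_inv] at h5
    rwa [Real.rpow_neg ht.le, ← Real.sqrt_eq_rpow]
  · intro t ht i j
    refine Real.abs_le_sqrt (((hF1 t i j).trans (hF2 t ht i j)).trans
      (mul_le_mul_of_nonneg_left ?_ hC0))
    refine (hae j (Set.mem_Ici.2 le_rfl) ht ht).trans ?_
    exact Finset.single_le_sum (f := fun j => matE A Γ (u 0) j j)
      (fun k _ => hE0 0 k) (Finset.mem_univ j)

end
end

section
/- Coordinate representation of the mapped deviations: along any solution of the continuous-time EnKF flow with y = A u†, there is a matrix-valued function L : [0,∞) → ℝ^{J×J} with L(0) = I satisfying dL/dt = −(1/J) E L, such that A e^{(j)}(t) = Σ_{k=1}^J L_{jk}(t) A e^{(k)}(0) for all j and all t ≥ 0. Moreover, if E(0) = X Λ(0) Xᵀ with X orthogonal and Λ(0) = diag(λ_0^{(1)},…,λ_0^{(J)}), then L(t) = X Ω(t) Xᵀ with Ω(t) = diag(ω^{(1)}(t),…,ω^{(J)}(t)) and ω^{(j)}(t) = ((2/J) λ_0^{(j)} t +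 1)^{-1/2}; in particular L(t) is invertible for every t ≥ 0. -/
open scoped BigOperators
open RealInnerProductSpace Matrix

noncomputable section

theorem ode_unique_aux {E : Type*} [NormedAddCommGroup E] [NormedSpace ℝ E]
    (F : E → E) (hF : ContDiff ℝ 1 F) (f g : ℝ → E)
    (hf : ∀ t ∈ Set.Ici (0:ℝ), HasDerivWithinAt f (F (f t)) (Set.Ici 0) t)
    (hg : ∀ t ∈ Set.Ici (0:ℝ), HasDerivWithinAt g (F (g t)) (Set.Ici 0) t)
    (h0 : f 0 = g 0) : ∀ t ∈ Set.Ici (0:ℝ), f t = g t := by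
  intro T hT
  have hfc : ContinuousOn f (Set.Icc 0 T) := fun t ht =>
    ((hf t ht.1).continuousWithinAt).mono Set.Icc_subset_Ici_self
  have hgc : ContinuousOn g (Set.Icc 0 T) := fun t ht =>
    ((hg t ht.1).continuousWithinAt).mono Set.Icc_subset_Ici_self
  have hc : IsCompact (f '' Set.Icc 0 T ∪ g '' Set.Icc 0 T) :=
    (isCompact_Icc.image_of_continuousOn hfc).union (isCompact_Icc.image_of_continuousOn hgc)
  obtain ⟨C, hC⟩ := (hF.locallyLipschitz.locallyLipschitzOn
    (s := f '' Set.Icc 0 T ∪ g '' Set.Icc 0 T)).exists_lipschitzOnWith_of_compact hc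
  refine ODE_solution_unique_of_mem_Icc_right (v := fun _ => F)
    (s := fun _ => f '' Set.Icc 0 T ∪ g '' Set.Icc 0 T) (K := C) (a := 0) (b := T)
    (fun _ _ => hC) hfc ?_ ?_ hgc ?_ ?_ h0 ⟨hT, le_refl T⟩
  · intro t ht
    exact (hf t ht.1).mono (Set.Ici_subset_Ici.2 ht.1)
  · intro t ht
    exact Or.inl ⟨t, ⟨ht.1, ht.2.le⟩, rfl⟩
  · intro t ht
    exact (hg t ht.1).mono (Set.Ici_subset_Ici.2 ht.1)
  · intro t ht
    exact Or.inr ⟨t, ⟨ht.1, ht.2.le⟩, rfl⟩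

theorem diag_fun_unique_aux {n : ℕ} (P Q : Matrix (Fin n) (Fin n) ℝ) (l m : Fin n → ℝ)
    (f : ℝ → ℝ) (hP : P * Pᵀ = 1) (hQ : Q * Qᵀ = 1)
    (h : P * Matrix.diagonal l * Pᵀ = Q * Matrix.diagonal m * Qᵀ) :
    P * Matrix.diagonal (fun j => f (l j)) * Pᵀ
      = Q * Matrix.diagonal (fun j => f (m j)) * Qᵀ := by
  have hP' : Pᵀ * P = 1 := mul_eq_one_comm.1 hP
  have hQ' : Qᵀ * Q = 1 := mul_eq_one_comm.1 hQ
  have h1 : Matrix.diagonal l * (Pᵀ * Q) = (Pᵀ * Q) * Matrix.diagonal m := by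
    calc Matrix.diagonal l * (Pᵀ * Q)
        = (Pᵀ * P) * Matrix.diagonal l * (Pᵀ * Q) := by rw [hP', one_mul]
      _ = Pᵀ * (P * Matrix.diagonal l * Pᵀ) * Q := by simp only [mul_assoc]
      _ = Pᵀ * (Q * Matrix.diagonal m * Qᵀ) * Q := by rw [h]
      _ = (Pᵀ * Q) * Matrix.diagonal m * (Qᵀ * Q) := by simp only [mul_assoc]
      _ = _ := by rw [hQ', mul_one]
  have h2 : Matrix.diagonal (fun j => f (l j)) * (Pᵀ * Q)
      = (Pᵀ * Q) * Matrix.diagonal (fun j => f (m j)) := by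
    ext i j
    have := congrFun (congrFun h1 i) j
    rw [Matrix.diagonal_mul, Matrix.mul_diagonal] at this ⊢
    by_cases hz : (Pᵀ * Q) i j = 0
    · simp [hz]
    · have : l i = m j := by
        apply mul_right_cancel₀ hz
        rw [this, mul_comm]
      rw [this, mul_comm]
  calc P * Matrix.diagonal (fun j => f (l j)) * Pᵀ
      = P * Matrix.diagonal (fun j => f (l j)) * Pᵀ * (Q * Qᵀ) := by rw [hQ, mul_one]
    _ = P * (Matrix.diagonal (fun j => f (l j)) * (Pᵀ * Q)) * Qᵀ := by simp only [mul_assoc]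
    _ = (P * Pᵀ) * Q * Matrix.diagonal (fun j => f (m j)) * Qᵀ := by
        rw [h2]; simp only [mul_assoc]
    _ = _ := by rw [hP, one_mul]

theorem conj_mul_aux {n : ℕ} (P : Matrix (Fin n) (Fin n) ℝ) (l m : Fin n → ℝ)
    (hP : P * Pᵀ = 1) :
    (P * Matrix.diagonal l * Pᵀ) * (P * Matrix.diagonal m * Pᵀ)
      = P * Matrix.diagonal (fun i => l i * m i) * Pᵀ := by
  have hP' : Pᵀ * P = 1 := mul_eq_one_comm.1 hP
  calc _ = P * Matrix.diagonal l * (Pᵀ * P) * Matrix.diagonal m * Pᵀ := by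
        simp only [mul_assoc]
    _ = P * (Matrix.diagonal l * Matrix.diagonal m) * Pᵀ := by
        rw [hP', mul_one]; simp only [mul_assoc]
    _ = _ := by rw [Matrix.diagonal_mul_diagonal]

theorem conj_transpose_aux {n : ℕ} (P : Matrix (Fin n) (Fin n) ℝ) (l : Fin n → ℝ) :
    (P * Matrix.diagonal l * Pᵀ)ᵀ = P * Matrix.diagonal l * Pᵀ := by
  simp [Matrix.transpose_mul, mul_assoc]

theorem conj_deriv_aux {n : ℕ} (P : Matrix (Fin n) (Fin n) ℝ) (w : ℝ → Fin n → ℝ)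
    (w' : Fin n → ℝ) (s : Set ℝ) (t : ℝ)
    (hw : ∀ i, HasDerivWithinAt (fun r => w r i) (w' i) s t) (i j : Fin n) :
    HasDerivWithinAt (fun r => (P * Matrix.diagonal (w r) * Pᵀ) i j)
      ((P * Matrix.diagonal w' * Pᵀ) i j) s t := by
  simp only [Matrix.mul_apply (M := P * Matrix.diagonal _), Matrix.mul_diagonal]
  apply HasDerivWithinAt.fun_sum
  intro k _
  exact ((hw k).const_mul _).mul_const _

theorem omega_deriv_aux (c l t : ℝ) (hc : 0 ≤ c) (hl : 0 ≤ l) (ht : 0 ≤ t) (s : Set ℝ) :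
    HasDerivWithinAt (fun r : ℝ => (2 * c * l * r + 1) ^ (-(1/2) : ℝ))
      (-c * (l * (2 * c * l * t + 1)⁻¹ * (2 * c * l * t + 1) ^ (-(1/2) : ℝ))) s t := by
  have hpos : 0 < 2 * c * l * t + 1 := by positivity
  have h1 : HasDerivAt (fun r : ℝ => 2 * c * l * r + 1) (2 * c * l) t := by
    simpa using ((hasDerivAt_id t).const_mul (2 * c * l)).add_const 1
  have h2 := (h1.rpow_const (p := (-(1/2) : ℝ)) (Or.inl hpos.ne')).hasDerivWithinAt (s := s)
  refine h2.congr_deriv ?_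
  rw [Real.rpow_sub hpos, Real.rpow_one]
  field_simp

theorem omega_sq_aux (x : ℝ) (hx : 0 < x) : x ^ (-(1/2) : ℝ) * x ^ (-(1/2) : ℝ) = x⁻¹ := by
  rw [← Real.rpow_add hx, ← Real.rpow_neg_one]; norm_num

theorem gInner_symm_aux {K : ℕ} (Γ : Matrix (Fin K) (Fin K) ℝ) (hΓ : Γ.PosDef)
    (a b : EuclideanSpace ℝ (Fin K)) : gInner Γ a b = gInner Γ b a := by
  have h := Matrix.isSymmetric_toEuclideanLin_iff.2 hΓ.inv.isHermitian
  unfold gInner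
  rw [h a b, real_inner_comm]

theorem gInner_nonneg_aux {K : ℕ} (Γ : Matrix (Fin K) (Fin K) ℝ) (hΓ : Γ.PosDef)
    (a : EuclideanSpace ℝ (Fin K)) : 0 ≤ gInner Γ a a := by
  have h := Matrix.isPositive_toEuclideanLin_iff.2 hΓ.inv.posSemidef
  simpa [gInner] using h.2 a

theorem gInner_sum_aux {K J : ℕ} (Γ : Matrix (Fin K) (Fin K) ℝ)
    (p q : Fin J → ℝ) (a : Fin J → EuclideanSpace ℝ (Fin K)) :
    gInner Γ (∑ k, p k • a k) (∑ k, q k • a k)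
      = ∑ k, ∑ l, p k * gInner Γ (a k) (a l) * q l := by
  simp only [gInner, map_sum, map_smul, sum_inner, inner_sum, inner_smul_left, inner_smul_right,
    Finset.mul_sum]
  rw [Finset.sum_comm]
  refine Finset.sum_congr rfl fun k _ => Finset.sum_congr rfl fun l _ => ?_
  simp only [conj_trivial]; ring

def gramG {K J : ℕ} (Γ : Matrix (Fin K) (Fin K) ℝ)
    (a : Fin J → EuclideanSpace ℝ (Fin K)) : Matrix (Fin J) (Fin J) ℝ :=
  Matrix.of fun l j => gInner Γ (a l) (a j)

def flowF {K J : ℕ} (Γ : Matrix (Fin K) (Fin K) ℝ)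
    (a : Fin J → EuclideanSpace ℝ (Fin K)) : Fin J → EuclideanSpace ℝ (Fin K) :=
  fun j => (-(J:ℝ)⁻¹) • ∑ k, gramG Γ a j k • a k

theorem flowF_contDiff {K J : ℕ} (Γ : Matrix (Fin K) (Fin K) ℝ) :
    ContDiff ℝ 1 (flowF Γ (J := J)) := by
  have hG : ∀ k : Fin J, ContDiff ℝ 1 (fun a : Fin J → EuclideanSpace ℝ (Fin K) =>
      Matrix.toEuclideanLin Γ⁻¹ (a k)) := fun k =>
    (LinearMap.toContinuousLinearMap (Matrix.toEuclideanLin Γ⁻¹)).contDiff.comp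
      (contDiff_apply ℝ (EuclideanSpace ℝ (Fin K)) k)
  rw [contDiff_pi]
  intro j
  unfold flowF gramG gInner
  simp only [Matrix.of_apply]
  refine ContDiff.const_smul _ ?_
  refine ContDiff.sum fun k _ => ?_
  exact ((hG j).inner ℝ (contDiff_apply ℝ (EuclideanSpace ℝ (Fin K)) k)).smul
    (contDiff_apply ℝ (EuclideanSpace ℝ (Fin K)) k)

theorem gramG_comb_aux {K J : ℕ} (Γ : Matrix (Fin K) (Fin K) ℝ)
    (M : Matrix (Fin J) (Fin J) ℝ) (a : Fin J → EuclideanSpace ℝ (Fin K)) :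
    gramG Γ (fun j => ∑ k, M j k • a k) = M * gramG Γ a * Mᵀ := by
  ext i j
  simp only [gramG, Matrix.of_apply, gInner_sum_aux, Matrix.mul_apply, Matrix.transpose_apply,
    Finset.sum_mul]
  rw [Finset.sum_comm]

theorem gramG_posSemidef {K J : ℕ} (Γ : Matrix (Fin K) (Fin K) ℝ) (hΓ : Γ.PosDef)
    (a : Fin J → EuclideanSpace ℝ (Fin K)) : (gramG Γ a).PosSemidef := by
  refine Matrix.PosSemidef.of_dotProduct_mulVec_nonneg ?_ ?_
  · ext i j
    simp [gramG, gInner_symm_aux Γ hΓ (a j) (a i)]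
  · intro x
    have h := gInner_nonneg_aux Γ hΓ (∑ k, x k • a k)
    rw [gInner_sum_aux] at h
    refine h.trans_eq ?_
    simp [dotProduct, Matrix.mulVec, gramG, Finset.mul_sum, mul_assoc]

theorem sol_deriv_aux {X : Type*} [NormedAddCommGroup X] [InnerProductSpace ℝ X]
    {K J : ℕ} (hJ : 0 < J)
    (A : X →L[ℝ] EuclideanSpace ℝ (Fin K))
    (Γ : Matrix (Fin K) (Fin K) ℝ) (hΓ : Γ.PosDef)
    (y : EuclideanSpace ℝ (Fin K)) (u : ℝ → Fin J → X)
    (hu : IsEnKFSolution A Γ y u) (t : ℝ) (ht : t ∈ Set.Ici (0:ℝ)) :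
    HasDerivWithinAt (fun s => fun j => A (u s j - ensMean (u s)))
      (flowF Γ (fun j => A (u t j - ensMean (u t)))) (Set.Ici 0) t := by
  rw [hasDerivWithinAt_pi]
  intro j
  have hm : HasDerivWithinAt (fun s => ensMean (u s))
      (ensMean (enkfRHS A Γ y (u t))) (Set.Ici 0) t := by
    unfold ensMean
    exact (HasDerivWithinAt.fun_sum fun k _ => hu k t ht).const_smul _
  have h := A.hasFDerivAt.comp_hasDerivWithinAt t ((hu j t ht).sub hm)
  refine h.congr_deriv ?_
  have hJ' : (J:ℝ) ≠ 0 := by positivity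
  have hmean : ensMean (enkfRHS A Γ y (u t))
      = (J : ℝ)⁻¹ • ∑ k, gInner Γ (A (u t k - ensMean (u t))) (y - A (ensMean (u t))) •
        (u t k - ensMean (u t)) := by
    conv_lhs => unfold ensMean
    simp only [enkfRHS]
    rw [← Finset.smul_sum, Finset.sum_comm]
    congr 2
    rw [Finset.smul_sum]
    refine Finset.sum_congr rfl fun k _ => ?_
    rw [← Finset.sum_smul, smul_smul]
    congr 1
    simp only [gInner]
    rw [← inner_sum, ← real_inner_smul_right]
    congr 1
    rw [Finset.sum_sub_distrib, smul_sub, Finset.sum_const, Finset.card_univ, Fintype.card_fin,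
      ← Nat.cast_smul_eq_nsmul ℝ, smul_smul, inv_mul_cancel₀ hJ', one_smul, ensMean, map_smul,
      map_sum]
  rw [hmean]
  simp only [enkfRHS, flowF, gramG, Matrix.of_apply]
  rw [← smul_sub, ← Finset.sum_sub_distrib, map_smul, map_sum, neg_smul, ← smul_neg,
    ← Finset.sum_neg_distrib]
  congr 1
  refine Finset.sum_congr rfl fun k _ => ?_
  rw [← sub_smul, map_smul, ← neg_smul]
  congr 1
  rw [gInner_symm_aux Γ hΓ (A (u t j - ensMean (u t)))]
  simp only [gInner]
  rw [← inner_sub_right, ← inner_neg_right]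
  congr 1
  rw [map_sub]; abel

theorem enkf_deviation_coordinate_representation
    {X : Type*} [NormedAddCommGroup X] [InnerProductSpace ℝ X]
    {K J : ℕ} (hJ : 0 < J)
    (A : X →L[ℝ] EuclideanSpace ℝ (Fin K))
    (Γ : Matrix (Fin K) (Fin K) ℝ) (hΓ : Γ.PosDef)
    (udag : X) (u : ℝ → Fin J → X)
    (hu : IsEnKFSolution A Γ (A udag) u) :
    ∃ L : ℝ → Matrix (Fin J) (Fin J) ℝ,
      L 0 = 1 ∧
      (∀ t ∈ Set.Ici (0 : ℝ), ∀ i j : Fin J,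
        HasDerivWithinAt (fun s => L s i j)
          ((-(J : ℝ)⁻¹) * (matE A Γ (u t) * L t) i j) (Set.Ici 0) t) ∧
      (∀ j : Fin J, ∀ t ∈ Set.Ici (0 : ℝ),
        A (u t j - ensMean (u t)) = ∑ k, L t j k • A (u 0 k - ensMean (u 0))) ∧
      (∀ t ∈ Set.Ici (0 : ℝ), IsUnit (L t)) ∧
      ∀ (X' : Matrix (Fin J) (Fin J) ℝ) (lam0 : Fin J → ℝ),
        X' * X'ᵀ = 1 →
        matE A Γ (u 0) = X' * Matrix.diagonal lam0 * X'ᵀ →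
        ∀ t ∈ Set.Ici (0 : ℝ),
          L t = X' * Matrix.diagonal
            (fun j => ((2 / (J : ℝ)) * lam0 j * t + 1) ^ (-(1 / 2) : ℝ)) * X'ᵀ := by
  have hJ0 : (0:ℝ) ≤ (J:ℝ)⁻¹ := by positivity
  set a : ℝ → Fin J → EuclideanSpace ℝ (Fin K) := fun s j => A (u s j - ensMean (u s)) with ha
  have hE : ∀ t, matE A Γ (u t) = gramG Γ (a t) := fun t => rfl
  have hps := gramG_posSemidef Γ hΓ (a 0)
  obtain ⟨P, lam, hP, hlam, hE0⟩ : ∃ (P : Matrix (Fin J) (Fin J) ℝ) (lam : Fin J → ℝ),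
      P * Pᵀ = 1 ∧ (∀ i, 0 ≤ lam i) ∧ gramG Γ (a 0) = P * Matrix.diagonal lam * Pᵀ := by
    refine ⟨hps.isHermitian.eigenvectorUnitary, hps.isHermitian.eigenvalues, ?_,
      hps.eigenvalues_nonneg, ?_⟩
    · have := Unitary.coe_mul_star_self hps.isHermitian.eigenvectorUnitary
      simpa [Matrix.star_eq_conjTranspose] using this
    · have := hps.isHermitian.spectral_theorem
      rw [Unitary.conjStarAlgAut_apply] at this
      simpa [Matrix.star_eq_conjTranspose, Function.comp_def] using this
  set w : ℝ → Fin J → ℝ := fun t i => (2 * (J:ℝ)⁻¹ * lam i * t + 1) ^ (-(1/2) : ℝ) with hw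
  set L : ℝ → Matrix (Fin J) (Fin J) ℝ := fun t => P * Matrix.diagonal (w t) * Pᵀ with hL
  have hpos : ∀ t ∈ Set.Ici (0:ℝ), ∀ i, 0 < 2 * (J:ℝ)⁻¹ * lam i * t + 1 := by
    intro t ht i
    have := hlam i
    have : (0:ℝ) ≤ t := ht
    positivity
  have hL0 : L 0 = 1 := by simp [hL, hw, hP]
  set b : ℝ → Fin J → EuclideanSpace ℝ (Fin K) := fun s j => ∑ k, L s j k • a 0 k with hb
  have hgb : ∀ t ∈ Set.Ici (0:ℝ), gramG Γ (b t)
      = P * Matrix.diagonal (fun i => lam i * (2 * (J:ℝ)⁻¹ * lam i * t + 1)⁻¹) * Pᵀ := by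
    intro t ht
    rw [hb]
    simp only
    rw [gramG_comb_aux, hE0, hL]
    simp only
    rw [conj_transpose_aux, conj_mul_aux _ _ _ hP, conj_mul_aux _ _ _ hP]
    congr 3
    funext i
    rw [← omega_sq_aux _ (hpos t ht i)]
    simp only [hw]; ring
  have hLd : ∀ t ∈ Set.Ici (0:ℝ), ∀ i j, HasDerivWithinAt (fun s => L s i j)
      ((-(J : ℝ)⁻¹) * (gramG Γ (b t) * L t) i j) (Set.Ici 0) t := by
    intro t ht i j
    have h := conj_deriv_aux P w _ (Set.Ici 0) t
      (fun i => omega_deriv_aux (J:ℝ)⁻¹ (lam i) t hJ0 (hlam i) ht (Set.Ici 0)) i j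
    refine h.congr_deriv ?_
    rw [hgb t ht, hL]
    simp only
    rw [conj_mul_aux _ _ _ hP]
    simp only [Matrix.mul_apply (M := P * Matrix.diagonal _), Matrix.mul_diagonal,
      Finset.mul_sum, hw]
    exact Finset.sum_congr rfl fun k _ => by ring
  have hab : ∀ t ∈ Set.Ici (0:ℝ), a t = b t := by
    refine ode_unique_aux (flowF Γ) (flowF_contDiff Γ) a b
      (fun t ht => sol_deriv_aux hJ A Γ hΓ _ u hu t ht) ?_ ?_
    · intro t ht
      rw [hasDerivWithinAt_pi]
      intro j
      have h : HasDerivWithinAt (fun s => ∑ k, L s j k • a 0 k) _ (Set.Ici 0) t :=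
        HasDerivWithinAt.fun_sum fun k _ => (hLd t ht j k).smul_const (a 0 k)
      refine h.congr_deriv ?_
      simp only [flowF]
      rw [Finset.smul_sum]
      have h2 : ∀ k, b t k = ∑ l, L t k l • a 0 l := fun k => rfl
      simp only [Matrix.mul_apply]
      generalize gramG Γ (b t) = G
      simp only [h2, Finset.mul_sum, Finset.sum_smul, Finset.smul_sum, smul_smul]
      rw [Finset.sum_comm]
    · funext j
      simp [hb, hL0, Matrix.one_apply]
  refine ⟨L, hL0, ?_, ?_, ?_, ?_⟩
  · intro t ht i j
    rw [hE t, hab t ht]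
    exact hLd t ht i j
  · intro j t ht
    exact congrFun (hab t ht) j
  · intro t ht
    refine IsUnit.of_mul_eq_one (P * Matrix.diagonal (fun i => (w t i)⁻¹) * Pᵀ) ?_
    rw [hL]
    simp only
    rw [conj_mul_aux _ _ _ hP]
    have : (fun i => w t i * (w t i)⁻¹) = fun _ => 1 := by
      funext i
      exact mul_inv_cancel₀ (Real.rpow_pos_of_pos (hpos t ht i) _).ne'
    rw [this, Matrix.diagonal_one, mul_one, hP]
  · intro Q m hQ hEQ t ht
    rw [hE, hE0] at hEQ
    have := diag_fun_unique_aux P Q lam m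
      (fun x => ((2 / (J : ℝ)) * x * t + 1) ^ (-(1 / 2) : ℝ)) hP hQ hEQ
    rw [← this]
    simp only [hL, hw, div_eq_mul_inv]

end
end

section
/- Invariance of the mapped deviation subspace: along any solution of the continuous-time EnKF flow with y = A u†, the linear span of {A e^{(j)}(t)}_{j=1}^J in Y is equal to the linear span of {A e^{(j)}(0)}_{j=1}^J for every t ≥ 0. -/
open scoped BigOperators
open RealInnerProductSpace Matrix

noncomputable section

theorem lin_ode_zero {J : ℕ} (M : ℝ → Fin J → Fin J → ℝ) (f : ℝ → Fin J → ℝ)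
    (hM : ∀ k j, ContinuousOn (fun t => M t k j) (Set.Ici 0))
    (hf : ∀ t ∈ Set.Ici (0 : ℝ), HasDerivWithinAt f (fun j => ∑ k, M t k j * f t k) (Set.Ici 0) t)
    (T : ℝ) (hT : 0 ≤ T) : f T = 0 ↔ f 0 = 0 := by
  have hBc : ContinuousOn (fun t => ∑ k, ∑ j, |M t k j|) (Set.Icc 0 T) := by
    refine continuousOn_finsetSum _ fun k _ => continuousOn_finsetSum _ fun j _ => ?_
    exact ((hM k j).mono Set.Icc_subset_Ici_self).abs
  obtain ⟨C, hC⟩ := isCompact_Icc.exists_bound_of_continuousOn hBc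
  have hlip : ∀ t ∈ Set.Icc 0 T, LipschitzOnWith C.toNNReal
      (fun (g : Fin J → ℝ) (j : Fin J) => ∑ k, M t k j * g k) Set.univ := by
    intro t ht
    refine (LipschitzWith.of_dist_le_mul fun g h => ?_).lipschitzOnWith
    have hCt : ∑ k, ∑ j, |M t k j| ≤ C := (le_abs_self _).trans (hC t ht)
    rw [dist_pi_le_iff (by positivity)]
    intro j
    rw [Real.dist_eq, ← Finset.sum_sub_distrib]
    calc |∑ k, (M t k j * g k - M t k j * h k)|
        ≤ ∑ k, |M t k j * g k - M t k j * h k| := Finset.abs_sum_le_sum_abs _ _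
      _ ≤ ∑ k, (∑ j, |M t k j|) * dist g h := by
          refine Finset.sum_le_sum fun k _ => ?_
          rw [← mul_sub, abs_mul]
          refine mul_le_mul ?_ ?_ (abs_nonneg _) (by positivity)
          · exact Finset.single_le_sum (f := fun j => |M t k j|) (fun _ _ => abs_nonneg _)
              (Finset.mem_univ j)
          · rw [← Real.dist_eq]; exact dist_le_pi_dist g h k
      _ = (∑ k, ∑ j, |M t k j|) * dist g h := by rw [Finset.sum_mul]
      _ ≤ C.toNNReal * dist g h := by
          refine mul_le_mul_of_nonneg_right (hCt.trans (Real.le_coe_toNNReal C)) dist_nonneg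
  have hfc : ContinuousOn f (Set.Icc 0 T) := fun t ht =>
    ((hf t ht.1).continuousWithinAt).mono Set.Icc_subset_Ici_self
  have hz : ∀ t (s : Set ℝ), HasDerivWithinAt (fun _ : ℝ => (0 : Fin J → ℝ))
      (fun j => ∑ k, M t k j * (0 : Fin J → ℝ) k) s t := by
    intro t s
    have : (fun j => ∑ k, M t k j * (0 : Fin J → ℝ) k) = 0 := by
      ext j; simp
    rw [this]; exact hasDerivWithinAt_const t s (0 : Fin J → ℝ)
  constructor
  · intro h
    have key := ODE_solution_unique_of_mem_Icc_left (E := Fin J → ℝ) (f := f) (a := 0) (b := T) (K := C.toNNReal) (s := fun _ => Set.univ) (g := fun _ => 0)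
      (v := fun t g j => ∑ k, M t k j * g k)
      (fun t ht => hlip t (Set.Ioc_subset_Icc_self ht)) hfc
      (fun t ht => ((hf t ht.1.le).hasDerivAt (Ici_mem_nhds ht.1)).hasDerivWithinAt)
      (fun _ _ => Set.mem_univ _) continuousOn_const (fun t _ => hz t _)
      (fun _ _ => Set.mem_univ _) h
    exact key (Set.left_mem_Icc.2 hT)
  · intro h
    have key := ODE_solution_unique_of_mem_Icc_right (E := Fin J → ℝ) (f := f) (a := 0) (b := T) (K := C.toNNReal) (s := fun _ => Set.univ) (g := fun _ => 0)
      (v := fun t g j => ∑ k, M t k j * g k)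
      (fun t ht => hlip t (Set.Ico_subset_Icc_self ht)) hfc
      (fun t ht => (hf t ht.1).mono (Set.Ici_subset_Ici.2 ht.1))
      (fun _ _ => Set.mem_univ _) continuousOn_const (fun t _ => hz t _)
      (fun _ _ => Set.mem_univ _) h
    exact key (Set.right_mem_Icc.2 hT)

theorem ensMean_RHS {X : Type*} [NormedAddCommGroup X] [InnerProductSpace ℝ X]
    {K J : ℕ} (hJ : 0 < J) (A : X →L[ℝ] EuclideanSpace ℝ (Fin K))
    (Γ : Matrix (Fin K) (Fin K) ℝ) (y : EuclideanSpace ℝ (Fin K)) (v : Fin J → X) (j : Fin J) :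
    enkfRHS A Γ y v j - ensMean (enkfRHS A Γ y v) =
      ∑ k, (-(J : ℝ)⁻¹ * gInner Γ (A (v k - ensMean v)) (A (v j - ensMean v))) •
        (v k - ensMean v) := by
  have hJ' : (J : ℝ) ≠ 0 := by positivity
  have h1 : ensMean (enkfRHS A Γ y v) = (J : ℝ)⁻¹ •
      ∑ k, gInner Γ (A (v k - ensMean v)) (y - A (ensMean v)) • (v k - ensMean v) := by
    have h2 : ∀ a, gInner Γ a (y - A (ensMean v)) = (J : ℝ)⁻¹ * ∑ i, gInner Γ a (y - A (v i)) := by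
      intro a
      simp only [gInner, ← inner_sum, ← inner_smul_right]
      congr 1
      rw [Finset.sum_sub_distrib, smul_sub]
      simp [ensMean, ← Nat.cast_smul_eq_nsmul ℝ, smul_smul, hJ']
    simp only [h2]
    conv_lhs => rw [ensMean]
    simp only [enkfRHS, ← Finset.smul_sum]
    congr 1
    rw [Finset.sum_comm, Finset.smul_sum]
    refine Finset.sum_congr rfl fun k _ => ?_
    rw [← Finset.sum_smul, smul_smul]
  rw [h1, enkfRHS, ← smul_sub, ← Finset.sum_sub_distrib, Finset.smul_sum]
  refine Finset.sum_congr rfl fun k _ => ?_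
  rw [← sub_smul, smul_smul]
  congr 1
  simp only [gInner, ← inner_sub_right]
  rw [neg_mul, ← mul_neg, ← inner_neg_right]
  congr 2
  rw [map_sub A (v j)]
  abel

theorem enkf_mapped_deviation_span_invariant
    {X : Type*} [NormedAddCommGroup X] [InnerProductSpace ℝ X]
    {K J : ℕ} (hJ : 0 < J)
    (A : X →L[ℝ] EuclideanSpace ℝ (Fin K))
    (Γ : Matrix (Fin K) (Fin K) ℝ) (hΓ : Γ.PosDef)
    (udag : X) (u : ℝ → Fin J → X)
    (hu : IsEnKFSolution A Γ (A udag) u) :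
    ∀ t ∈ Set.Ici (0 : ℝ),
      Submodule.span ℝ (Set.range fun j => A (u t j - ensMean (u t))) =
        Submodule.span ℝ (Set.range fun j => A (u 0 j - ensMean (u 0))) := by
  intro t ht
  have hdev : ∀ j, ∀ t ∈ Set.Ici (0 : ℝ),
      HasDerivWithinAt (fun s => A (u s j - ensMean (u s)))
        (∑ k, (-(J : ℝ)⁻¹ * gInner Γ (A (u t k - ensMean (u t))) (A (u t j - ensMean (u t)))) •
          A (u t k - ensMean (u t))) (Set.Ici 0) t := by
    intro j t ht
    have hm : HasDerivWithinAt (fun s => ensMean (u s))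
        (ensMean (enkfRHS A Γ (A udag) (u t))) (Set.Ici 0) t := by
      unfold ensMean
      exact (HasDerivWithinAt.fun_sum fun i _ => hu i t ht).const_smul _
    have h := A.hasFDerivAt.comp_hasDerivWithinAt t ((hu j t ht).sub hm)
    rw [ensMean_RHS hJ, map_sum] at h
    simp only [_root_.map_smul] at h
    exact h
  have hcont : ∀ j, ContinuousOn (fun s => A (u s j - ensMean (u s))) (Set.Ici 0) :=
    fun j t ht => (hdev j t ht).continuousWithinAt
  have key : ∀ w : EuclideanSpace ℝ (Fin K),
      (∀ j, ⟪w, A (u t j - ensMean (u t))⟫ = 0) ↔ (∀ j, ⟪w, A (u 0 j - ensMean (u 0))⟫ = 0) := by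
    intro w
    have := lin_ode_zero
      (fun t k j => -(J : ℝ)⁻¹ * gInner Γ (A (u t k - ensMean (u t))) (A (u t j - ensMean (u t))))
      (fun t j => ⟪w, A (u t j - ensMean (u t))⟫) ?_ ?_ t ht
    · simpa only [funext_iff, Pi.zero_apply] using this
    · intro k j
      unfold gInner
      refine continuousOn_const.mul (ContinuousOn.inner ?_ (hcont j))
      exact (LinearMap.continuous_of_finiteDimensional
        (Matrix.toEuclideanLin Γ⁻¹)).comp_continuousOn (hcont k)
    · intro s hs
      rw [hasDerivWithinAt_pi]
      intro j
      have h := (innerSL ℝ w).hasFDerivAt.comp_hasDerivWithinAt s (hdev j s hs)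
      rw [map_sum] at h
      simp only [_root_.map_smul, innerSL_apply_apply, smul_eq_mul] at h
      exact h
  rw [← Submodule.orthogonal_orthogonal (Submodule.span ℝ (Set.range fun j => A (u t j - _))),
    ← Submodule.orthogonal_orthogonal (Submodule.span ℝ (Set.range fun j => A (u 0 j - _)))]
  congr 1
  have mem : ∀ (a : Fin J → EuclideanSpace ℝ (Fin K)) w,
      w ∈ (Submodule.span ℝ (Set.range a))ᗮ ↔ ∀ j, ⟪w, a j⟫ = 0 := by
    intro a w
    rw [Submodule.mem_orthogonal']
    constructor
    · intro h j
      exact h _ (Submodule.subset_span ⟨j, rfl⟩)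
    · intro h x hx
      induction hx using Submodule.span_induction with
      | mem x hx => obtain ⟨j, rfl⟩ := hx; exact h j
      | zero => simp
      | add x y _ _ hx hy => rw [inner_add_right, hx, hy, add_zero]
      | smul c x _ hx => rw [inner_smul_right, hx, mul_zero]
  ext w
  rw [mem, mem]
  exact key w


end
end
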